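/- Let X be a real normed space of dimension at least 2 with D-A-F angle ang. Then the following are equivalent: (i) ang(x,y) + ang(−x,y) ≤ π for all x,y ∈ X_o; (ii) ang(x,y) + ang(−x,y) ≥ π for all x,y ∈ X_o; (iii) ang(x,y) + ang(−x,y) = π for all x,y ∈ X_o; (iv) X is an inner product space, i.e., the parallelogram law ‖x+y‖² + ‖x−y‖² = 2‖x‖² + 2‖y‖² holds for all x,y ∈ X. -/

import Mathlib

open Real

/-- The Diminnie-Andalafte-Freese angle of a normed space. -/
noncomputable def angDAF {X : Type*} [NormedAddCommGroup X] [NormedSpace ℝ X]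
    (x y : X) : ℝ :=
  Real.arccos (1 - (1 / 2) * ‖‖x‖⁻¹ • x - ‖y‖⁻¹ • y‖ ^ 2)

/-- The binary quadratic form with coefficients `c`, evaluated at `p`. -/
def binaryForm (c : ℝ × ℝ × ℝ) (p : ℝ × ℝ) : ℝ :=
  c.1 * p.1 ^ 2 + c.2.1 * (p.1 * p.2) + c.2.2 * p.2 ^ 2

lemma binaryForm_smul (c : ℝ × ℝ × ℝ) (t : ℝ) (p : ℝ × ℝ) :
    binaryForm c (t • p) = t ^ 2 * binaryForm c p := by
  simp only [binaryForm, Prod.smul_fst, Prod.smul_snd, smul_eq_mul]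
  ring

lemma continuous_binaryForm (c : ℝ × ℝ × ℝ) : Continuous (binaryForm c) := by
  unfold binaryForm
  fun_prop

lemma continuous_binaryForm_coeff (p : ℝ × ℝ) : Continuous fun c => binaryForm c p := by
  unfold binaryForm
  fun_prop

lemma isCompact_euclidean_circle : IsCompact {p : ℝ × ℝ | p.1 ^ 2 + p.2 ^ 2 = 1} := by
  refine (isCompact_Icc (a := ((-1, -1) : ℝ × ℝ)) (b := (1, 1))).of_isClosed_subset
    (isClosed_eq (by fun_prop) (by fun_prop)) ?_
  rintro ⟨a, b⟩ h
  simp only [Set.mem_ofPred_eq] at h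
  simp only [Set.mem_Icc, Prod.mk_le_mk]
  refine ⟨⟨?_, ?_⟩, ?_, ?_⟩ <;> nlinarith [sq_nonneg a, sq_nonneg b]

lemma sq_add_sq_pos_of_ne_zero {p : ℝ × ℝ} (hp : p ≠ 0) : 0 < p.1 ^ 2 + p.2 ^ 2 := by
  rcases eq_or_ne p.1 0 with h1 | h1
  · have h2 : p.2 ≠ 0 := fun h2 => hp (Prod.ext h1 h2)
    positivity
  · positivity

/-- A 2-homogeneous function dominated by another one on the circle is dominated everywhere. -/
lemma le_of_le_on_circle {f g : ℝ × ℝ → ℝ}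
    (hf : ∀ (t : ℝ) p, f (t • p) = t ^ 2 * f p) (hg : ∀ (t : ℝ) p, g (t • p) = t ^ 2 * g p)
    (h : ∀ p : ℝ × ℝ, p.1 ^ 2 + p.2 ^ 2 = 1 → g p ≤ f p) (p : ℝ × ℝ) : g p ≤ f p := by
  by_cases hp : p = 0
  · have h1 := hf 0 0
    have h2 := hg 0 0
    simp only [smul_zero] at h1 h2
    rw [hp]
    linarith
  have hpos := sq_add_sq_pos_of_ne_zero hp
  set r := √(p.1 ^ 2 + p.2 ^ 2) with hr
  have hr0 : 0 < r := Real.sqrt_pos.2 hpos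
  have hr2 : r ^ 2 = p.1 ^ 2 + p.2 ^ 2 := Real.sq_sqrt hpos.le
  have hp' : p = r • (r⁻¹ • p) := by rw [smul_smul, mul_inv_cancel₀ hr0.ne', one_smul]
  rw [hp', hf, hg]
  refine mul_le_mul_of_nonneg_left (h _ ?_) (sq_nonneg r)
  simp only [Prod.smul_fst, Prod.smul_snd, smul_eq_mul, mul_pow, inv_pow]
  rw [← mul_add, ← hr2, inv_mul_cancel₀ (by positivity)]

/-- If `R` is positive wherever the form `c` touches `g`, then a small multiple of `R` can be added
to `c` while still dominating `g`. -/
lemma exists_pos_binaryForm_add_smul_ge {g : ℝ × ℝ → ℝ} (hgc : Continuous g)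
    (hg : ∀ (t : ℝ) p, g (t • p) = t ^ 2 * g p) {c R : ℝ × ℝ × ℝ}
    (hc : ∀ p, g p ≤ binaryForm c p)
    (hR : ∀ p ≠ 0, binaryForm c p = g p → 0 < binaryForm R p) :
    ∃ ε : ℝ, 0 < ε ∧ ∀ p, g p ≤ binaryForm (c + ε • R) p := by
  have hadd : ∀ (ε : ℝ) p, binaryForm (c + ε • R) p = binaryForm c p + ε * binaryForm R p := by
    intro ε p
    simp only [binaryForm, Prod.fst_add, Prod.snd_add, Prod.smul_fst, Prod.smul_snd, smul_eq_mul]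
    ring
  have hK : IsCompact ({p : ℝ × ℝ | p.1 ^ 2 + p.2 ^ 2 = 1} ∩ {p | binaryForm R p ≤ 0}) :=
    isCompact_euclidean_circle.inter_right
      (isClosed_le (continuous_binaryForm R) continuous_const)
  suffices h : ∃ ε : ℝ, 0 < ε ∧ ∀ p : ℝ × ℝ, p.1 ^ 2 + p.2 ^ 2 = 1 → binaryForm R p ≤ 0 →
      g p ≤ binaryForm c p + ε * binaryForm R p by
    obtain ⟨ε, hε, h⟩ := h
    refine ⟨ε, hε, le_of_le_on_circle (binaryForm_smul _) hg fun p hp => ?_⟩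
    rw [hadd]
    rcases le_total (binaryForm R p) 0 with h0 | h0
    · exact h p hp h0
    · nlinarith [hc p, mul_nonneg hε.le h0]
  rcases Set.eq_empty_or_nonempty
    ({p : ℝ × ℝ | p.1 ^ 2 + p.2 ^ 2 = 1} ∩ {p | binaryForm R p ≤ 0}) with he | hne
  · exact ⟨1, one_pos, fun p hp h0 =>
      (Set.eq_empty_iff_forall_notMem.1 he p ⟨hp, h0⟩).elim⟩
  obtain ⟨q, hq, hqmin⟩ := hK.exists_isMinOn hne
    ((continuous_binaryForm c).sub hgc).continuousOn
  obtain ⟨s, hs, hsmin⟩ := hK.exists_isMinOn hne (continuous_binaryForm R).continuousOn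
  have hδ : 0 < binaryForm c q - g q := by
    refine sub_pos.2 (lt_of_le_of_ne (hc q) fun heq => ?_)
    have hq0 : q ≠ 0 := by
      rintro rfl
      simpa using hq.1
    exact (hR q hq0 heq.symm).not_ge hq.2
  have hL : 0 < 1 - binaryForm R s := by
    have := hs.2
    simp only [Set.mem_ofPred_eq] at this
    linarith
  refine ⟨(binaryForm c q - g q) / (1 - binaryForm R s), div_pos hδ hL, fun p hp h0 => ?_⟩
  have h1 : binaryForm c q - g q ≤ binaryForm c p - g p := hqmin ⟨hp, h0⟩
  have h2 : binaryForm R s ≤ binaryForm R p := hsmin ⟨hp, h0⟩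
  set ε := (binaryForm c q - g q) / (1 - binaryForm R s) with hε
  have h3 : ε * (1 - binaryForm R s) = binaryForm c q - g q := div_mul_cancel₀ _ hL.ne'
  have h4 : 0 < ε := div_pos hδ hL
  nlinarith [mul_le_mul_of_nonneg_left h2 h4.le]

/-- Among the forms dominating `g` there is one of minimal trace. -/
lemma exists_binaryForm_ge_minimal_trace {g : ℝ × ℝ → ℝ} (hgc : Continuous g)
    (hg : ∀ (t : ℝ) p, g (t • p) = t ^ 2 * g p) :
    ∃ c : ℝ × ℝ × ℝ, (∀ p, g p ≤ binaryForm c p) ∧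
      ∀ d : ℝ × ℝ × ℝ, (∀ p, g p ≤ binaryForm d p) → c.1 + c.2.2 ≤ d.1 + d.2.2 := by
  obtain ⟨M, hM⟩ := isCompact_euclidean_circle.exists_bound_of_continuousOn hgc.continuousOn
  have hup : ∀ p, g p ≤ binaryForm (M, 0, M) p :=
    le_of_le_on_circle (binaryForm_smul _) hg fun p hp => by
      have := (abs_le.1 (hM p hp)).2
      simp only [binaryForm]
      linear_combination this - M * hp
  have hlo : ∀ p, binaryForm (-M, 0, -M) p ≤ g p :=
    le_of_le_on_circle hg (binaryForm_smul _) fun p hp => by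
      have := (abs_le.1 (hM p hp)).1
      simp only [binaryForm]
      linear_combination this - M * hp
  let S : Set (ℝ × ℝ × ℝ) := {c | ∀ p, g p ≤ binaryForm c p} ∩ {c | c.1 + c.2.2 ≤ 2 * M}
  have hScl : IsClosed S := by
    refine IsClosed.inter ?_ (isClosed_le (by fun_prop) (by fun_prop))
    simp only [Set.ofPred_forall]
    exact isClosed_iInter fun p =>
      isClosed_le continuous_const (continuous_binaryForm_coeff p)
  have hS : IsCompact S := by
    refine (isCompact_Icc (a := ((-M, -4 * M, -M) : ℝ × ℝ × ℝ))
      (b := (3 * M, 4 * M, 3 * M))).of_isClosed_subset hScl ?_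
    rintro ⟨A, B, C⟩ ⟨h, hT⟩
    have h1 := (hlo (1, 0)).trans (h (1, 0))
    have h2 := (hlo (0, 1)).trans (h (0, 1))
    have h3 := (hlo (1, 1)).trans (h (1, 1))
    have h4 := (hlo (1, -1)).trans (h (1, -1))
    simp only [binaryForm, Set.mem_ofPred_eq] at h1 h2 h3 h4 hT
    simp only [Set.mem_Icc, Prod.mk_le_mk]
    refine ⟨⟨?_, ?_, ?_⟩, ?_, ?_, ?_⟩ <;> linarith
  have hmem : ((M, 0, M) : ℝ × ℝ × ℝ) ∈ S := ⟨hup, by simp [two_mul]⟩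
  obtain ⟨c, hc, hmin⟩ := hS.exists_isMinOn ⟨_, hmem⟩
    (f := fun c : ℝ × ℝ × ℝ => c.1 + c.2.2) (by fun_prop)
  refine ⟨c, hc.1, fun d hd => ?_⟩
  by_cases hdT : d.1 + d.2.2 ≤ 2 * M
  · exact hmin (⟨hd, hdT⟩ : d ∈ S)
  · have h2 : c.1 + c.2.2 ≤ 2 * M := hc.2
    linarith

/-- Some quadratic form dominates `g` and touches it along two independent directions. -/
lemma exists_binaryForm_ge_touching {g : ℝ × ℝ → ℝ} (hgc : Continuous g)
    (hg : ∀ (t : ℝ) p, g (t • p) = t ^ 2 * g p) :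
    ∃ c : ℝ × ℝ × ℝ, (∀ p, g p ≤ binaryForm c p) ∧
      ∃ p q : ℝ × ℝ, p.1 * q.2 - p.2 * q.1 ≠ 0 ∧ binaryForm c p = g p ∧ binaryForm c q = g q := by
  obtain ⟨c, hc, hmin⟩ := exists_binaryForm_ge_minimal_trace hgc hg
  refine ⟨c, hc, ?_⟩
  by_contra! hno
  obtain ⟨u, hu0, hu⟩ : ∃ u : ℝ × ℝ, u ≠ 0 ∧
      ∀ p ≠ 0, binaryForm c p = g p → p.1 * u.2 - p.2 * u.1 = 0 := by
    by_cases h : ∃ u : ℝ × ℝ, u ≠ 0 ∧ binaryForm c u = g u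
    · obtain ⟨u, hu0, hu⟩ := h
      refine ⟨u, hu0, fun p _ hp => ?_⟩
      by_contra hne
      exact hno p u hne hp hu
    · push Not at h
      exact ⟨(1, 0), by simp, fun p hp0 hp => absurd hp (h p hp0)⟩
  obtain ⟨ε, hε, h⟩ := exists_pos_binaryForm_add_smul_ge hgc hg
    (R := (u.1 ^ 2 - 2 * u.2 ^ 2, 6 * u.1 * u.2, u.2 ^ 2 - 2 * u.1 ^ 2)) hc fun p hp0 hp => by
      have h0 := hu p hp0 hp
      have key : binaryForm (u.1 ^ 2 - 2 * u.2 ^ 2, 6 * u.1 * u.2, u.2 ^ 2 - 2 * u.1 ^ 2) p =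
          (p.1 ^ 2 + p.2 ^ 2) * (u.1 ^ 2 + u.2 ^ 2) - 3 * (p.1 * u.2 - p.2 * u.1) ^ 2 := by
        simp only [binaryForm]
        ring
      rw [key, h0]
      nlinarith [mul_pos (sq_add_sq_pos_of_ne_zero hp0) (sq_add_sq_pos_of_ne_zero hu0)]
  have h1 := hmin _ h
  simp only [Prod.fst_add, Prod.snd_add, Prod.smul_fst, Prod.smul_snd, smul_eq_mul] at h1
  nlinarith [mul_pos hε (sq_add_sq_pos_of_ne_zero hu0)]

/-- A closed subset of `ℝ` meeting the open interval between any two of its points is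
order-convex. -/
lemma Icc_subset_of_isClosed_of_exists_between {S : Set ℝ} (hS : IsClosed S)
    (hmid : ∀ a ∈ S, ∀ b ∈ S, a < b → ∃ m ∈ S, a < m ∧ m < b) {a b : ℝ}
    (ha : a ∈ S) (hb : b ∈ S) : Set.Icc a b ⊆ S := by
  intro x hx
  obtain ⟨s, hs, hsmax⟩ := (isCompact_Icc.inter_left hS).exists_isGreatest
    (⟨a, ha, le_rfl, hx.1⟩ : (S ∩ Set.Icc a x).Nonempty)
  obtain ⟨t, ht, htmin⟩ := (isCompact_Icc.inter_left hS).exists_isLeast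
    (⟨b, hb, hx.2, le_rfl⟩ : (S ∩ Set.Icc x b).Nonempty)
  rcases (hs.2.2.trans ht.2.1).eq_or_lt with hst | hst
  · have : x = s := le_antisymm (hst ▸ ht.2.1) hs.2.2
    exact this ▸ hs.1
  · obtain ⟨m, hm, h1, h2⟩ := hmid s hs.1 t ht.1 hst
    rcases le_total m x with hmx | hmx
    · exact absurd (hsmax ⟨hm, hs.2.1.trans h1.le, hmx⟩) h1.not_ge
    · exact absurd (htmin ⟨hm, hmx, h2.le.trans ht.2.2⟩) h2.not_ge

section

variable {X : Type*} [NormedAddCommGroup X] [NormedSpace ℝ X]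

/-- A closed double cone in the plane containing two independent vectors and closed under taking
sums of vectors of equal norm is the whole plane. -/
lemma mem_of_isClosed_cone {f : ℝ × ℝ →ₗ[ℝ] X} (hf : ∀ p, f p = 0 → p = 0)
    {K : Set (ℝ × ℝ)} (hK : IsClosed K) (hsmul : ∀ (t : ℝ), ∀ p ∈ K, t • p ∈ K)
    (hadd : ∀ p ∈ K, ∀ q ∈ K, ‖f p‖ = 1 → ‖f q‖ = 1 → p + q ∈ K)
    {p q : ℝ × ℝ} (hp : p ∈ K) (hq : q ∈ K) (hpq : p.1 * q.2 - p.2 * q.1 ≠ 0) (x : ℝ × ℝ) :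
    x ∈ K := by
  have key : ∀ p ∈ K, ∀ q ∈ K, p.1 * q.2 - p.2 * q.1 ≠ 0 → ∀ a b : ℝ, 0 ≤ a → 0 ≤ b →
      a • p + b • q ∈ K := by
    intro p hp q hq hpq a b ha hb
    have hne : ∀ t : ℝ, (1 - t) • p + t • q ≠ 0 := by
      intro t ht
      have h1 := congrArg Prod.fst ht
      have h2 := congrArg Prod.snd ht
      simp only [Prod.fst_add, Prod.snd_add, Prod.smul_fst, Prod.smul_snd, smul_eq_mul,
        Prod.fst_zero, Prod.snd_zero] at h1 h2
      have h3 : (1 - t) * (p.1 * q.2 - p.2 * q.1) = 0 := by linear_combination q.2 * h1 - q.1 * h2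
      have h4 : t * (p.1 * q.2 - p.2 * q.1) = 0 := by linear_combination p.1 * h2 - p.2 * h1
      have h5 := (mul_eq_zero.1 h3).resolve_right hpq
      have h6 := (mul_eq_zero.1 h4).resolve_right hpq
      linarith
    have hS : IsClosed {t : ℝ | (1 - t) • p + t • q ∈ K} :=
      hK.preimage (f := fun t : ℝ => (1 - t) • p + t • q) (by fun_prop)
    have hsub := Icc_subset_of_isClosed_of_exists_between hS (a := 0) (b := 1) (by
      intro s hs t ht hst
      set y := (1 - s) • p + s • q with hy
      set z := (1 - t) • p + t • q with hz
      have hyn : 0 < ‖f y‖ := norm_pos_iff.2 fun h => hne s (hf _ h)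
      have hzn : 0 < ‖f z‖ := norm_pos_iff.2 fun h => hne t (hf _ h)
      have hα : 0 < ‖f y‖⁻¹ := inv_pos.2 hyn
      have hβ : 0 < ‖f z‖⁻¹ := inv_pos.2 hzn
      have hmem := hadd (‖f y‖⁻¹ • y) (hsmul _ _ hs) (‖f z‖⁻¹ • z) (hsmul _ _ ht)
        (by rw [map_smul, norm_smul, norm_inv, norm_norm, inv_mul_cancel₀ hyn.ne'])
        (by rw [map_smul, norm_smul, norm_inv, norm_norm, inv_mul_cancel₀ hzn.ne'])
      set α := ‖f y‖⁻¹
      set β := ‖f z‖⁻¹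
      have hαβ : 0 < α + β := add_pos hα hβ
      refine ⟨(α * s + β * t) / (α + β), ?_, ?_, ?_⟩
      · have h := hsmul (α + β)⁻¹ _ hmem
        have heq : (1 - (α * s + β * t) / (α + β)) • p + ((α * s + β * t) / (α + β)) • q =
            (α + β)⁻¹ • (α • y + β • z) := by
          rw [hy, hz]
          ext <;> simp <;> field_simp <;> ring
        simpa only [Set.mem_ofPred_eq, heq] using h
      · rw [lt_div_iff₀ hαβ]
        nlinarith
      · rw [div_lt_iff₀ hαβ]
        nlinarith) (by simpa using hp) (by simpa using hq)
    rcases (add_nonneg ha hb).eq_or_lt with h0 | h0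
    · have ha0 : a = 0 := by linarith
      have hb0 : b = 0 := by linarith
      simpa [ha0, hb0] using hsmul 0 p hp
    · have h := hsmul (a + b) _
        (hsub (⟨by positivity, (div_le_one h0).2 (by linarith)⟩ : b / (a + b) ∈ Set.Icc (0 : ℝ) 1))
      have heq : (a + b) • ((1 - b / (a + b)) • p + (b / (a + b)) • q) = a • p + b • q := by
        ext <;> simp <;> field_simp <;> ring
      rwa [heq] at h
  have hneg : ∀ p ∈ K, -p ∈ K := fun p hp => by simpa using hsmul (-1) p hp
  obtain ⟨a, b, rfl⟩ : ∃ a b : ℝ, x = a • p + b • q := by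
    refine ⟨(x.1 * q.2 - x.2 * q.1) / (p.1 * q.2 - p.2 * q.1),
      (p.1 * x.2 - p.2 * x.1) / (p.1 * q.2 - p.2 * q.1), ?_⟩
    ext <;> simp only [Prod.fst_add, Prod.snd_add, Prod.smul_fst, Prod.smul_snd, smul_eq_mul] <;>
      rw [div_mul_eq_mul_div, div_mul_eq_mul_div, ← add_div, eq_div_iff hpq] <;> ring
  rcases le_total 0 a with ha | ha <;> rcases le_total 0 b with hb | hb
  · exact key p hp q hq hpq a b ha hb
  · simpa using key p hp (-q) (hneg q hq) (by simpa using fun h => hpq (by linarith))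
      a (-b) ha (by linarith)
  · simpa using key (-p) (hneg p hp) q hq (by simpa using fun h => hpq (by linarith))
      (-a) b (by linarith) hb
  · simpa using key (-p) (hneg p hp) (-q) (hneg q hq) (by simpa using hpq)
      (-a) (-b) (by linarith) (by linarith)

/-- **Day's theorem**: a one-sided parallelogram law for unit vectors, in either direction
(according to the sign of `σ`), implies the parallelogram law. -/
theorem parallelogram_law_of_unit_vectors {σ : ℝ} (hσ : σ ≠ 0)
    (h : ∀ u v : X, ‖u‖ = 1 → ‖v‖ = 1 → σ * 4 ≤ σ * (‖u + v‖ ^ 2 + ‖u - v‖ ^ 2)) (x y : X) :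
    ‖x + y‖ ^ 2 + ‖x - y‖ ^ 2 = 2 * ‖x‖ ^ 2 + 2 * ‖y‖ ^ 2 := by
  by_cases hxy : LinearIndependent ℝ ![x, y]
  · rw [LinearIndependent.pair_iff] at hxy
    let f : ℝ × ℝ →ₗ[ℝ] X :=
      (LinearMap.fst ℝ ℝ ℝ).smulRight x + (LinearMap.snd ℝ ℝ ℝ).smulRight y
    have hfa : ∀ p, f p = p.1 • x + p.2 • y := fun p => rfl
    have hf : ∀ p, f p = 0 → p = 0 := fun p hp =>
      Prod.ext (hxy p.1 p.2 hp).1 (hxy p.1 p.2 hp).2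
    have hfc : Continuous f := f.continuous_of_finiteDimensional
    have hgc : Continuous fun p => σ * ‖f p‖ ^ 2 := by fun_prop
    have hg : ∀ (t : ℝ) p, σ * ‖f (t • p)‖ ^ 2 = t ^ 2 * (σ * ‖f p‖ ^ 2) := by
      intro t p
      rw [map_smul, norm_smul, mul_pow, Real.norm_eq_abs, sq_abs]
      ring
    obtain ⟨c, hc, p, q, hpq, hp, hq⟩ := exists_binaryForm_ge_touching hgc hg
    have hall : ∀ r, binaryForm c r = σ * ‖f r‖ ^ 2 := by
      refine mem_of_isClosed_cone hf (K := {r | binaryForm c r = σ * ‖f r‖ ^ 2})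
        (isClosed_eq (continuous_binaryForm c) hgc) ?_ ?_ hp hq hpq
      · intro t r hr
        simp only [Set.mem_ofPred_eq] at hr ⊢
        rw [binaryForm_smul, hg, hr]
      · intro r hr s hs hr1 hs1
        simp only [Set.mem_ofPred_eq] at hr hs ⊢
        have h1 := h _ _ hr1 hs1
        rw [← map_add, ← map_sub] at h1
        have h2 := hc (r + s)
        have h3 := hc (r - s)
        have h4 : binaryForm c (r + s) + binaryForm c (r - s) =
            2 * binaryForm c r + 2 * binaryForm c s := by
          simp only [binaryForm, Prod.fst_add, Prod.snd_add, Prod.fst_sub, Prod.snd_sub]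
          ring
        rw [hr, hs, hr1, hs1] at h4
        linarith
    have h1 := hall (1, 1)
    have h2 := hall (1, -1)
    have h3 := hall (1, 0)
    have h4 := hall (0, 1)
    simp only [hfa, binaryForm, one_smul, neg_smul, zero_smul, zero_add, add_zero,
      ← sub_eq_add_neg] at h1 h2 h3 h4
    refine mul_left_cancel₀ hσ ?_
    linear_combination 2 * h3 + 2 * h4 - h1 - h2
  · by_cases hx : x = 0
    · simp [hx]
      ring
    · rw [LinearIndependent.pair_iff' hx] at hxy
      push Not at hxy
      obtain ⟨a, rfl⟩ := hxy
      have h1 : x + a • x = (1 + a) • x := by rw [add_smul, one_smul]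
      have h2 : x - a • x = (1 - a) • x := by rw [sub_smul, one_smul]
      rw [h1, h2]
      simp only [norm_smul, mul_pow, Real.norm_eq_abs, sq_abs]
      ring

/-- Comparing the angle sum with `π` amounts to comparing the diagonals of a rhombus with those of
a square. -/
lemma angDAF_add_angDAF_neg_compare {x y : X} (hx : x ≠ 0) (hy : y ≠ 0) :
    (angDAF x y + angDAF (-x) y ≤ Real.pi ↔
      ‖‖x‖⁻¹ • x + ‖y‖⁻¹ • y‖ ^ 2 + ‖‖x‖⁻¹ • x - ‖y‖⁻¹ • y‖ ^ 2 ≤ 4) ∧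
    (Real.pi ≤ angDAF x y + angDAF (-x) y ↔
      4 ≤ ‖‖x‖⁻¹ • x + ‖y‖⁻¹ • y‖ ^ 2 + ‖‖x‖⁻¹ • x - ‖y‖⁻¹ • y‖ ^ 2) := by
  have hu : ‖‖x‖⁻¹ • x‖ = 1 := norm_smul_inv_norm (𝕜 := ℝ) hx
  have hv : ‖‖y‖⁻¹ • y‖ = 1 := norm_smul_inv_norm (𝕜 := ℝ) hy
  unfold angDAF
  rw [norm_neg, smul_neg, ← neg_add', norm_neg]
  set u := ‖x‖⁻¹ • x
  set v := ‖y‖⁻¹ • y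
  have hs : ‖u - v‖ ≤ 2 := (norm_sub_le u v).trans (by rw [hu, hv]; norm_num)
  have ha : ‖u + v‖ ≤ 2 := (norm_add_le u v).trans (by rw [hu, hv]; norm_num)
  have hs0 := norm_nonneg (u - v)
  have ha0 := norm_nonneg (u + v)
  have hA : 1 - 1 / 2 * ‖u - v‖ ^ 2 ∈ Set.Icc (-1 : ℝ) 1 := by constructor <;> nlinarith
  have hB : -(1 - 1 / 2 * ‖u + v‖ ^ 2) ∈ Set.Icc (-1 : ℝ) 1 := by constructor <;> nlinarith
  have h1 := Real.strictAntiOn_arccos.le_iff_ge hA hB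
  have h2 := Real.strictAntiOn_arccos.le_iff_ge hB hA
  rw [Real.arccos_neg] at h1 h2
  refine ⟨?_, ?_⟩
  · rw [← le_sub_iff_add_le, h1]
    constructor <;> intro h <;> linarith
  · rw [← sub_le_iff_le_add, h2]
    constructor <;> intro h <;> linarith

end

theorem angDAF_weak_supplementarity_iff_inner_product
    {X : Type*} [NormedAddCommGroup X] [NormedSpace ℝ X]
    (hdim : 2 ≤ Module.rank ℝ X) :
    [(∀ x y : X, x ≠ 0 → y ≠ 0 → angDAF x y + angDAF (-x) y ≤ Real.pi),
     (∀ x y : X, x ≠ 0 → y ≠ 0 → Real.pi ≤ angDAF x y + angDAF (-x) y),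
     (∀ x y : X, x ≠ 0 → y ≠ 0 → angDAF x y + angDAF (-x) y = Real.pi),
     (∀ x y : X, ‖x + y‖ ^ 2 + ‖x - y‖ ^ 2 = 2 * ‖x‖ ^ 2 + 2 * ‖y‖ ^ 2)].TFAE := by
  tfae_have 1 → 4 := by
    intro h
    refine parallelogram_law_of_unit_vectors (σ := -1) (by norm_num) fun u v hu hv => ?_
    have hu0 : u ≠ 0 := norm_ne_zero_iff.1 (by simp [hu])
    have hv0 : v ≠ 0 := norm_ne_zero_iff.1 (by simp [hv])
    have h1 := (angDAF_add_angDAF_neg_compare hu0 hv0).1.1 (h u v hu0 hv0)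
    rw [hu, hv, inv_one, one_smul, one_smul] at h1
    linarith
  tfae_have 2 → 4 := by
    intro h
    refine parallelogram_law_of_unit_vectors (σ := 1) one_ne_zero fun u v hu hv => ?_
    have hu0 : u ≠ 0 := norm_ne_zero_iff.1 (by simp [hu])
    have hv0 : v ≠ 0 := norm_ne_zero_iff.1 (by simp [hv])
    have h1 := (angDAF_add_angDAF_neg_compare hu0 hv0).2.1 (h u v hu0 hv0)
    rw [hu, hv, inv_one, one_smul, one_smul] at h1
    linarith
  tfae_have 3 → 1 := fun h x y hx hy => (h x y hx hy).le
  tfae_have 3 → 2 := fun h x y hx hy => (h x y hx hy).ge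
  tfae_have 4 → 3 := by
    intro h x y hx hy
    have h1 := h (‖x‖⁻¹ • x) (‖y‖⁻¹ • y)
    have hu : ‖‖x‖⁻¹ • x‖ = 1 := norm_smul_inv_norm (𝕜 := ℝ) hx
    have hv : ‖‖y‖⁻¹ • y‖ = 1 := norm_smul_inv_norm (𝕜 := ℝ) hy
    rw [hu, hv] at h1
    have h2 := angDAF_add_angDAF_neg_compare hx hy
    exact le_antisymm (h2.1.2 (by linarith)) (h2.2.2 (by linarith))
  tfae_finish
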